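/- arXiv:2202.07812 — 2 statements merged into one kernel-verified Lean document; each statement's English description precedes it below -/
import Mathlib

section
/- Let p be a prime and let (M, φ, t) be a span program over ℤ_p on n input bits, where M is a d × e matrix, computing f : {0,1}^n → {0,1}. Suppose t_e ≠ 0 and there is a fixed input index k ∈ {1,…,n} such that every row i of M with M_{i,e} ≠ 0 has label φ(i) = (k, 1). Then f(z) = 1 implies z_k = 1; consequently f is no-cloning, i.e., f(z) = 1 implies f(¬z) = 0. -/
/-- The output of a span program `(M, φ, t)` over `ℤ_p` on input `z`:
it is `1` (i.e. `True`) iff the target vector `t` lies in the span of the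
rows of `M` activated by `z`, where row `i` is activated iff `z (φ i).1 = (φ i).2`. -/
def SpanProgramAccepts {p n d e : ℕ} (M : Matrix (Fin d) (Fin e) (ZMod p))
    (φ : Fin d → Fin n × Bool) (t : Fin e → ZMod p) (z : Fin n → Bool) : Prop :=
  t ∈ Submodule.span (ZMod p) ((fun i => M i) '' {i | z (φ i).1 = (φ i).2})

/-- The span program `(M, φ, t)` computes the Boolean function `f`. -/
def SpanProgramComputes {p n d e : ℕ} (M : Matrix (Fin d) (Fin e) (ZMod p))
    (φ : Fin d → Fin n × Bool) (t : Fin e → ZMod p)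
    (f : (Fin n → Bool) → Bool) : Prop :=
  ∀ z : Fin n → Bool, (f z = true ↔ SpanProgramAccepts M φ t z)

/-- If the target has a nonzero coordinate `j`, every accepting input activates a row whose
`j`-th entry is nonzero. -/
theorem SpanProgramAccepts.exists_activated_row_ne_zero {p n d e : ℕ}
    {M : Matrix (Fin d) (Fin e) (ZMod p)} {φ : Fin d → Fin n × Bool} {t : Fin e → ZMod p}
    {z : Fin n → Bool} (h : SpanProgramAccepts M φ t z) {j : Fin e} (hj : t j ≠ 0) :
    ∃ i, z (φ i).1 = (φ i).2 ∧ M i j ≠ 0 := by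
  by_contra! hzero
  have hle : Submodule.span (ZMod p) ((fun i => M i) '' {i | z (φ i).1 = (φ i).2}) ≤
      LinearMap.ker (LinearMap.proj (R := ZMod p) (φ := fun _ : Fin e => ZMod p) j) := by
    rw [Submodule.span_le]
    rintro _ ⟨i, hi, rfl⟩
    exact hzero i hi
  exact hj (hle h)

/-- suppose the span program `(M, φ, t)` over `ℤ_p` on `n`
input bits computes `f`, the last coordinate of the target vector is
nonzero, and every row with a nonzero entry in the last column is labelled
`(k, 1)` for one fixed input index `k`. Then `f(z) = 1` implies `z_k = 1`;
consequently `f` is no-cloning: `f(z) = 1` implies `f(¬z) = 0`. -/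
theorem span_program_last_column_no_cloning
    {p n d e : ℕ} (hp : p.Prime)
    (M : Matrix (Fin d) (Fin (e + 1)) (ZMod p))
    (φ : Fin d → Fin n × Bool) (t : Fin (e + 1) → ZMod p) (ht : t ≠ 0)
    (f : (Fin n → Bool) → Bool)
    (hcomp : SpanProgramComputes M φ t f)
    (htlast : t (Fin.last e) ≠ 0)
    (k : Fin n)
    (hcol : ∀ i : Fin d, M i (Fin.last e) ≠ 0 → φ i = (k, true)) :
    (∀ z : Fin n → Bool, f z = true → z k = true) ∧
    (∀ z : Fin n → Bool, f z = true → f (fun i => !z i) = false) := by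
  have hk : ∀ z : Fin n → Bool, f z = true → z k = true := by
    intro z hz
    obtain ⟨i, hi, hne⟩ := ((hcomp z).mp hz).exists_activated_row_ne_zero htlast
    simpa [hcol i hne] using hi
  refine ⟨hk, fun z hz => Bool.eq_false_iff.mpr fun hnz => ?_⟩
  simpa [hk z hz] using hk _ hnz
end

section
/- (Decomposition lemma.) Let p be a prime and let f : {0,1}^m → {0,1} be a Boolean function computed by some span program over ℤ_p, and let SP_p(f) denote the minimal size of such a span program. Then there exist functions f' : {0,1}^{m+1} → {0,1}, f_I : {0,1}^{2m+1} → {0,1}, and g : {0,1}^{m+1} → {0,1}^{2m+1} such that: (i) f'(z, 1) = f(z) for all z ∈ {0,1}^m; (ii) f'(z, b) = f_I(g(z, b)) for all (z, b) ∈ {0,1}^{m+1}; (iii) f_I is a valid indicator function, i.e., monotone and no-cloning; (iv) g acts on the first m bits by copying each bit and negating one copy, z_i ↦ (z_i, ¬z_i), and leaves the final bit b unchanged; and (v) mSP_p(f_I) ≤ SP_p(f) + 1, i.e., f_I is computed by a monotone span program over ℤ_p of size at most SP_p(f) + 1. -/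
/-- `f` is computed by some span program over `ℤ_p` of size `d`. -/
def HasSpanProgram (p : ℕ) {n : ℕ} (d : ℕ) (f : (Fin n → Bool) → Bool) : Prop :=
  ∃ (e : ℕ) (M : Matrix (Fin d) (Fin e) (ZMod p))
    (φ : Fin d → Fin n × Bool) (t : Fin e → ZMod p),
    t ≠ 0 ∧ SpanProgramComputes M φ t f

/-- `f` is computed by some monotone span program over `ℤ_p` of size `d`. -/
def HasMonotoneSpanProgram (p : ℕ) {n : ℕ} (d : ℕ)
    (f : (Fin n → Bool) → Bool) : Prop :=
  ∃ (e : ℕ) (M : Matrix (Fin d) (Fin e) (ZMod p))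
    (φ : Fin d → Fin n × Bool) (t : Fin e → ZMod p),
    t ≠ 0 ∧ (∀ i : Fin d, (φ i).2 = true) ∧ SpanProgramComputes M φ t f

/-- `SP_p(f)`: the minimal size of a span program over `ℤ_p` computing `f`. -/
noncomputable def SPsize (p : ℕ) {n : ℕ} (f : (Fin n → Bool) → Bool) : ℕ :=
  sInf {d : ℕ | HasSpanProgram p d f}

/-- A monotone Boolean function. -/
def MonotoneBool {n : ℕ} (f : (Fin n → Bool) → Bool) : Prop :=
  ∀ x y : Fin n → Bool, (∀ i : Fin n, x i ≤ y i) → f x ≤ f y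

/-- A no-cloning Boolean function: `f(z) = 1` implies `f(¬z) = 0`. -/
def NoCloning {n : ℕ} (f : (Fin n → Bool) → Bool) : Prop :=
  ∀ z : Fin n → Bool, f z = true → f (fun i => !z i) = false

/-- The matrix `M` bordered by a zero column and by the last standard basis row. -/
def borderedMatrix {R : Type*} [Zero R] [One R] {d e : ℕ} (M : Matrix (Fin d) (Fin e) R) :
    Matrix (Fin (d + 1)) (Fin (e + 1)) R :=
  Fin.snoc (α := fun _ => Fin (e + 1) → R)
    (fun i => Fin.snoc (α := fun _ => R) (M i) 0) (Fin.snoc (α := fun _ => R) 0 1)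

/-- The vector `(t, 1)` lies in the span of selected rows of the bordered matrix iff the last row
is selected and `t` lies in the span of the selected rows of the original matrix. -/
theorem snoc_one_mem_span_borderedMatrix {R : Type*} [CommRing R] [Nontrivial R] {d e : ℕ}
    (M : Matrix (Fin d) (Fin e) R) (t : Fin e → R) (P : Fin (d + 1) → Prop) :
    (Fin.snoc (α := fun _ => R) t 1 : Fin (e + 1) → R) ∈
        Submodule.span R ((fun i => borderedMatrix M i) '' {i | P i}) ↔
      P (Fin.last d) ∧ t ∈ Submodule.span R ((fun i => M i) '' {i | P i.castSucc}) := by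
  constructor
  · intro h
    constructor
    · by_contra hP
      have hle : Submodule.span R ((fun i => borderedMatrix M i) '' {i | P i}) ≤
          LinearMap.ker (LinearMap.proj (R := R) (φ := fun _ : Fin (e + 1) => R) (Fin.last e)) := by
        rw [Submodule.span_le]
        rintro _ ⟨i, hi, rfl⟩
        induction i using Fin.lastCases with
        | last => exact absurd hi hP
        | cast i => simp [borderedMatrix]
      simpa using hle h
    · have hle : Submodule.span R ((fun i => borderedMatrix M i) '' {i | P i}) ≤
          (Submodule.span R ((fun i => M i) '' {i | P i.castSucc})).comap
            (LinearMap.funLeft R R (Fin.castSucc : Fin e → Fin (e + 1))) := by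
        rw [Submodule.span_le]
        rintro _ ⟨i, hi, rfl⟩
        induction i using Fin.lastCases with
        | last =>
          have h0 : LinearMap.funLeft R R (Fin.castSucc : Fin e → Fin (e + 1))
              (borderedMatrix M (Fin.last d)) = 0 := by
            ext j
            simp [borderedMatrix, LinearMap.funLeft_apply]
          simp [h0]
        | cast i =>
          have h0 : LinearMap.funLeft R R (Fin.castSucc : Fin e → Fin (e + 1))
              (borderedMatrix M i.castSucc) = M i := by
            ext j
            simp [borderedMatrix, LinearMap.funLeft_apply]
          simp only [Submodule.comap_coe, Set.mem_preimage, h0]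
          exact Submodule.subset_span ⟨i, hi, rfl⟩
      have ht := hle h
      have h0 : LinearMap.funLeft R R (Fin.castSucc : Fin e → Fin (e + 1))
          (Fin.snoc (α := fun _ => R) t 1) = t := by
        ext j
        simp [LinearMap.funLeft_apply]
      rwa [Submodule.mem_comap, h0] at ht
  · rintro ⟨hP, ht⟩
    let ι : (Fin e → R) →ₗ[R] (Fin (e + 1) → R) :=
      { toFun := fun v => Fin.snoc (α := fun _ => R) v 0
        map_add' := fun v w => by
          ext j
          induction j using Fin.lastCases <;> simp
        map_smul' := fun c v => by
          ext j
          induction j using Fin.lastCases <;> simp }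
    have hle : Submodule.span R ((fun i => M i) '' {i | P i.castSucc}) ≤
        (Submodule.span R ((fun i => borderedMatrix M i) '' {i | P i})).comap ι := by
      rw [Submodule.span_le]
      rintro _ ⟨i, hi, rfl⟩
      exact Submodule.subset_span ⟨i.castSucc, hi, by simp [borderedMatrix, ι]⟩
    have hlast : borderedMatrix M (Fin.last d) ∈
        Submodule.span R ((fun i => borderedMatrix M i) '' {i | P i}) :=
      Submodule.subset_span ⟨Fin.last d, hP, rfl⟩
    have hsum : (Fin.snoc (α := fun _ => R) t 1 : Fin (e + 1) → R) =
        ι t + borderedMatrix M (Fin.last d) := by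
      ext j
      induction j using Fin.lastCases <;> simp [borderedMatrix, ι]
    rw [hsum]
    exact Submodule.add_mem _ (hle ht) hlast

/-- The index, among the `m + m` bits `(z, ¬z)`, of the bit that is `1` exactly when
`z l.1 = l.2`. -/
def literalIndex {m : ℕ} (l : Fin m × Bool) : Fin (m + m) :=
  if l.2 then Fin.castAdd m l.1 else Fin.natAdd m l.1

theorem append_not_literalIndex {m : ℕ} (z : Fin m → Bool) (l : Fin m × Bool) :
    Fin.append z (fun i => !z i) (literalIndex l) = true ↔ z l.1 = l.2 := by
  obtain ⟨k, ε⟩ := l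
  cases ε <;> simp [literalIndex, -Fin.natAdd_eq_addNat]

/-- Decomposition lemma: if `f : {0,1}^m → {0,1}` is computed
by some span program over `ℤ_p` (`p` prime), then there are
`f' : {0,1}^{m+1} → {0,1}`, `f_I : {0,1}^{2m+1} → {0,1}` and
`g : {0,1}^{m+1} → {0,1}^{2m+1}` such that (i) `f'(z,1) = f(z)`;
(ii) `f' = f_I ∘ g`; (iii) `f_I` is a valid indicator function (monotone
and no-cloning); (iv) `g(z,b) = (z, ¬z, b)`, copying each bit of `z` and
negating one copy while leaving `b` unchanged; and (v) `f_I` is computed by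
a monotone span program over `ℤ_p` of size at most `SP_p(f) + 1`. -/
theorem decomposition_lemma
    {p m : ℕ} (hp : p.Prime)
    (f : (Fin m → Bool) → Bool)
    (hf : ∃ d : ℕ, HasSpanProgram p d f) :
    ∃ (f' : (Fin (m + 1) → Bool) → Bool)
      (fI : (Fin (m + m + 1) → Bool) → Bool)
      (g : (Fin (m + 1) → Bool) → (Fin (m + m + 1) → Bool)),
      (∀ z : Fin m → Bool, f' (Fin.snoc z true) = f z) ∧
      (∀ w : Fin (m + 1) → Bool, f' w = fI (g w)) ∧
      (MonotoneBool fI ∧ NoCloning fI) ∧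
      (∀ w : Fin (m + 1) → Bool,
        g w = Fin.snoc
          (Fin.append (fun i : Fin m => w i.castSucc)
            (fun i : Fin m => !w i.castSucc))
          (w (Fin.last m))) ∧
      (∃ d : ℕ, d ≤ SPsize p f + 1 ∧ HasMonotoneSpanProgram p d fI) := by
  classical
  have : Fact p.Prime := ⟨hp⟩
  obtain ⟨e, M, φ, t, -, hcomp⟩ : HasSpanProgram p (SPsize p f) f := Nat.sInf_mem hf
  let g : (Fin (m + 1) → Bool) → (Fin (m + m + 1) → Bool) := fun w =>
    Fin.snoc (Fin.append (fun i : Fin m => w i.castSucc) (fun i : Fin m => !w i.castSucc))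
      (w (Fin.last m))
  let A : (Fin (m + m + 1) → Bool) → Submodule (ZMod p) (Fin e → ZMod p) := fun x =>
    Submodule.span (ZMod p) ((fun i => M i) '' {i | x (literalIndex (φ i)).castSucc = true})
  let fI : (Fin (m + m + 1) → Bool) → Bool := fun x =>
    decide (x (Fin.last (m + m)) = true ∧ t ∈ A x)
  have fI_iff : ∀ x, fI x = true ↔ x (Fin.last (m + m)) = true ∧ t ∈ A x := fun x =>
    decide_eq_true_iff
  refine ⟨fun w => fI (g w), fI, g, fun z => ?_, fun _ => rfl, ⟨fun x y hxy => ?_, fun x hx => ?_⟩,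
    fun _ => rfl, SPsize p f + 1, le_rfl, e + 1, borderedMatrix M,
    Fin.snoc (α := fun _ => Fin (m + m + 1) × Bool)
      (fun i => ((literalIndex (φ i)).castSucc, true)) (Fin.last (m + m), true),
    Fin.snoc (α := fun _ => ZMod p) t 1, fun h => ?_, fun i => ?_, fun x => ?_⟩
  · rw [Bool.eq_iff_iff, fI_iff, hcomp z]
    simp [A, g, SpanProgramAccepts, append_not_literalIndex]
  · rw [Bool.le_iff_imp, fI_iff, fI_iff]
    rintro ⟨hlast, ht⟩
    refine ⟨Bool.le_iff_imp.1 (hxy _) hlast, Submodule.span_mono (Set.image_mono ?_) ht⟩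
    exact fun i hi => Bool.le_iff_imp.1 (hxy _) hi
  · refine Bool.eq_false_iff.2 fun h => ?_
    simpa [((fI_iff x).1 hx).1] using ((fI_iff fun i => !x i).1 h).1
  · simpa using congrFun h (Fin.last e)
  · induction i using Fin.lastCases <;> simp
  · rw [fI_iff, SpanProgramAccepts, snoc_one_mem_span_borderedMatrix M t]
    simp [A]
end
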